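/- Let W_n be the number of white balls at time n in a large-index urn (model M or model R) with 1/2 < Λ < 1, let 𝒲_n := g_n(W_n − E[W_n]), X_n := 𝒲_n − 𝒲_{n−1} for n ≥ 1, and s_n² := Σ_{i=n}^{∞} E[X_i²]. Then, as n → ∞: almost surely E[X_{n+1}² | F_n] ~ n^{−2Λ}·a_m b_0 Q² Λ²/(m(1−Λ)²); also E[X_{n+1}²] ~ n^{−2Λ}·a_m b_0 Q² Λ²/(m(1−Λ)²); and s_n² ~ n^{1−2Λ}·a_m b_0 Q² Λ²/(m(2Λ−1)(1−Λ)²). -/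

import Mathlib

open MeasureTheory ProbabilityTheory Filter Set Topology

noncomputable section

/-- Probability of drawing `k` white balls in a sample of size `m` from an urn with
`w` white and `b` black balls, drawing *without* replacement (model M). -/
def sampleProbM (m k w b : ℕ) : ℝ :=
  (Nat.choose w k * Nat.choose b (m - k) : ℝ) / (Nat.choose (w + b) m : ℝ)

/-- Probability of drawing `k` white balls in a sample of size `m` from an urn with
`w` white and `b` black balls, drawing *with* replacement (model R). -/
def sampleProbR (m k w b : ℕ) : ℝ :=
  (Nat.choose m k : ℝ) * (w : ℝ) ^ k * (b : ℝ) ^ (m - k) / ((w : ℝ) + (b : ℝ)) ^ m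

/-- A balanced affine tenable two-color urn scheme with multiple drawings.
`mdlM = true` is model M (sampling without replacement), `mdlM = false` is model R
(sampling with replacement).  `W n`, `B n` are the numbers of white and black balls
after `n` draws (ℕ-valued, which encodes tenability), `R (n+1)` is the number of white
balls in the `(n+1)`-st sample, and `F` is the filtration generated by the draws. -/
structure UrnScheme {Ω : Type*} [m0 : MeasurableSpace Ω] (μ : Measure Ω)
    (mdlM : Bool) (m : ℕ) (a b : ℕ → ℤ) (σ : ℤ) (W0 B0 : ℕ)
    (W B : ℕ → Ω → ℕ) (R : ℕ → Ω → ℕ) (F : Filtration ℕ m0) : Prop where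
  hm : 1 ≤ m
  hσ : 1 ≤ σ
  balanced : ∀ k ≤ m, a k + b k = σ
  affine : ∀ k ≤ m, a k = ((m : ℤ) - (k : ℤ)) * (a (m - 1) - a m) + a m
  initW : ∀ ω, W 0 ω = W0
  initB : ∀ ω, B 0 ω = B0
  sampleLe : ∀ n ω, R (n + 1) ω ≤ m
  sampleFit : ∀ n ω, (if mdlM then m else 1) ≤ W n ω + B n ω
  dynW : ∀ n ω, (W (n + 1) ω : ℤ) = (W n ω : ℤ) + a (m - R (n + 1) ω)
  dynB : ∀ n ω, (B (n + 1) ω : ℤ) = (B n ω : ℤ) + b (m - R (n + 1) ω)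
  measW : ∀ n, Measurable[F n] (W n)
  measB : ∀ n, Measurable[F n] (B n)
  measR : ∀ n, Measurable[F (n + 1)] (R (n + 1))
  condLaw : ∀ n, ∀ k ≤ m,
      (μ[(({ω | R (n + 1) ω = k}).indicator fun _ => (1 : ℝ)) | F n])
        =ᵐ[μ] fun ω =>
          if mdlM then sampleProbM m k (W n ω) (B n ω)
          else sampleProbR m k (W n ω) (B n ω)

/-- The urn index `Λ = m (a_{m-1} - a_m) / σ`. -/
def urnIndex (m : ℕ) (a : ℕ → ℤ) (σ : ℤ) : ℝ :=
  (m : ℝ) * ((a (m - 1) : ℝ) - (a m : ℝ)) / (σ : ℝ)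

/-- `ζ = a_m / (1 - Λ)`. -/
def urnZeta (m : ℕ) (a : ℕ → ℤ) (σ : ℤ) : ℝ :=
  (a m : ℝ) / (1 - urnIndex m a σ)

/-- `Q = Γ(T₀/σ + Λ) / Γ(T₀/σ)`. -/
def urnQ (T0 : ℕ) (σ : ℤ) (Λ : ℝ) : ℝ :=
  Real.Gamma ((T0 : ℝ) / (σ : ℝ) + Λ) / Real.Gamma ((T0 : ℝ) / (σ : ℝ))

/-- `g_n = Q · Γ(n + T₀/σ) / Γ(n + T₀/σ + Λ)`. -/
def urnG (T0 : ℕ) (σ : ℤ) (Λ : ℝ) (n : ℕ) : ℝ :=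
  urnQ T0 σ Λ * Real.Gamma ((n : ℝ) + (T0 : ℝ) / (σ : ℝ)) /
    Real.Gamma ((n : ℝ) + (T0 : ℝ) / (σ : ℝ) + Λ)

/-- Convergence in distribution of the sequence `X n` (on `(Ω, μ)`) to the law `ν`,
i.e. weak convergence of the image measures. -/
def TendstoInDistribution {Ω : Type*} [MeasurableSpace Ω] (μ : Measure Ω)
    (X : ℕ → Ω → ℝ) (ν : Measure ℝ) : Prop :=
  ∀ f : BoundedContinuousFunction ℝ ℝ,
    Tendsto (fun n => ∫ ω, f (X n ω) ∂μ) atTop (𝓝 (∫ x, f x ∂ν))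

/-- The martingale `𝒲_n = g_n (W_n - E[W_n])` for large-index urns. -/
def calW {Ω : Type*} [MeasurableSpace Ω] (μ : Measure Ω) (σ : ℤ) (Λ : ℝ) (T0 : ℕ)
    (W : ℕ → Ω → ℕ) (n : ℕ) (ω : Ω) : ℝ :=
  urnG T0 σ Λ n * ((W n ω : ℝ) - ∫ ω', (W n ω' : ℝ) ∂μ)

/-- The scaling constant `α = ((1-Λ)/(QΛ)) √(m(2Λ-1)/(a_m b_0))`. -/
def alphaConst (m : ℕ) (a b : ℕ → ℤ) (σ : ℤ) (T0 : ℕ) : ℝ :=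
  (1 - urnIndex m a σ) / (urnQ T0 σ (urnIndex m a σ) * urnIndex m a σ) *
    Real.sqrt ((m : ℝ) * (2 * urnIndex m a σ - 1) / ((a m : ℝ) * (b 0 : ℝ)))

/-- The martingale differences `X_n = 𝒲_n - 𝒲_{n-1}`. -/
def calX {Ω : Type*} [MeasurableSpace Ω] (μ : Measure Ω) (σ : ℤ) (Λ : ℝ) (T0 : ℕ)
    (W : ℕ → Ω → ℕ) (n : ℕ) (ω : Ω) : ℝ :=
  calW μ σ Λ T0 W n ω - calW μ σ Λ T0 W (n - 1) ω

/-! ### Asymptotics of Gamma quotients -/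

lemma Real.Gamma_nat_add_one_add {s : ℝ} (hs : 0 < s) (n : ℕ) :
    Real.Gamma ((n : ℝ) + 1 + s) = Real.Gamma s * ∏ j ∈ Finset.range (n + 1), (s + j) := by
  induction n with
  | zero => simp [add_comm (1 : ℝ) s, Real.Gamma_add_one hs.ne', mul_comm]
  | succ n ih =>
    rw [Finset.prod_range_succ, ← mul_assoc, ← ih]
    have h : (n : ℝ) + 1 + s ≠ 0 := by positivity
    have := Real.Gamma_add_one h
    push_cast
    rw [show (n : ℝ) + 1 + 1 + s = n + 1 + s + 1 by ring, this]
    ring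

lemma tendsto_Gamma_div_rpow_mul_factorial {s : ℝ} (hs : 0 < s) :
    Tendsto (fun n : ℕ => Real.Gamma ((n : ℝ) + 1 + s) / ((n : ℝ) ^ s * n.factorial)) atTop
      (𝓝 1) := by
  have hG := Real.Gamma_pos_of_pos hs
  have h := (tendsto_const_nhds (x := Real.Gamma s)).div (Real.GammaSeq_tendsto_Gamma s) hG.ne'
  rw [div_self hG.ne'] at h
  refine h.congr fun n => ?_
  rw [Pi.div_apply, Real.Gamma_nat_add_one_add hs, Real.GammaSeq, div_div_eq_mul_div]

lemma tendsto_Gamma_div_Gamma_mul_rpow {s t : ℝ} (hs : 0 < s) (ht : 0 < t) :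
    Tendsto (fun n : ℕ => Real.Gamma ((n : ℝ) + 1 + s) / Real.Gamma ((n : ℝ) + 1 + (s + t)) *
      (n : ℝ) ^ t) atTop (𝓝 1) := by
  have h := (tendsto_Gamma_div_rpow_mul_factorial hs).div
    (tendsto_Gamma_div_rpow_mul_factorial (add_pos hs ht)) one_ne_zero
  rw [div_one] at h
  refine h.congr' ?_
  filter_upwards [eventually_gt_atTop 0] with n hn
  have hn' : (0 : ℝ) < n := by exact_mod_cast hn
  have h1 : (n : ℝ) ^ s ≠ 0 := (Real.rpow_pos_of_pos hn' _).ne'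
  have h2 : (n : ℝ) ^ t ≠ 0 := (Real.rpow_pos_of_pos hn' _).ne'
  have h3 : (n.factorial : ℝ) ≠ 0 := by positivity
  have h4 : Real.Gamma ((n : ℝ) + 1 + (s + t)) ≠ 0 := (Real.Gamma_pos_of_pos (by positivity)).ne'
  simp only [Pi.div_apply]
  rw [Real.rpow_add hn']
  field_simp

lemma urnQ_pos {T0 : ℕ} {σ : ℤ} {Λ : ℝ} (hT : 0 < T0) (hσ : 1 ≤ σ) (hΛ : 0 < Λ) :
    0 < urnQ T0 σ Λ := by
  have : (0 : ℝ) < σ := by exact_mod_cast hσ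
  have : (0 : ℝ) < T0 := by exact_mod_cast hT
  exact div_pos (Real.Gamma_pos_of_pos (by positivity)) (Real.Gamma_pos_of_pos (by positivity))

lemma urnG_pos {T0 : ℕ} {σ : ℤ} {Λ : ℝ} (hT : 0 < T0) (hσ : 1 ≤ σ) (hΛ : 0 < Λ) (n : ℕ) :
    0 < urnG T0 σ Λ n := by
  have h1 : (0 : ℝ) < σ := by exact_mod_cast hσ
  have h2 : (0 : ℝ) < T0 := by exact_mod_cast hT
  exact div_pos (mul_pos (urnQ_pos hT hσ hΛ) (Real.Gamma_pos_of_pos (by positivity)))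
    (Real.Gamma_pos_of_pos (by positivity))

lemma urnG_succ_mul {T0 : ℕ} {σ : ℤ} {Λ : ℝ} (hT : 0 < T0) (hσ : 1 ≤ σ) (hΛ : 0 < Λ) (n : ℕ) :
    urnG T0 σ Λ (n + 1) * ((n : ℝ) + (T0 : ℝ) / σ + Λ) =
      urnG T0 σ Λ n * ((n : ℝ) + (T0 : ℝ) / σ) := by
  have h1 : (0 : ℝ) < σ := by exact_mod_cast hσ
  have h2 : (0 : ℝ) < T0 := by exact_mod_cast hT
  have h3 : (0 : ℝ) < (n : ℝ) + (T0 : ℝ) / σ := by positivity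
  have h4 : (0 : ℝ) < (n : ℝ) + (T0 : ℝ) / σ + Λ := by positivity
  have h5 := Real.Gamma_pos_of_pos h4
  unfold urnG
  push_cast
  rw [show (n : ℝ) + 1 + (T0 : ℝ) / σ = n + (T0 : ℝ) / σ + 1 by ring,
    show (n : ℝ) + (T0 : ℝ) / σ + 1 + Λ = n + (T0 : ℝ) / σ + Λ + 1 by ring,
    Real.Gamma_add_one h3.ne', Real.Gamma_add_one h4.ne']
  field_simp

lemma tendsto_urnG_succ_mul_rpow {T0 : ℕ} {σ : ℤ} {Λ : ℝ} (hT : 0 < T0) (hσ : 1 ≤ σ)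
    (hΛ : 0 < Λ) :
    Tendsto (fun n : ℕ => urnG T0 σ Λ (n + 1) * (n : ℝ) ^ Λ) atTop (𝓝 (urnQ T0 σ Λ)) := by
  have h1 : (0 : ℝ) < σ := by exact_mod_cast hσ
  have h2 : (0 : ℝ) < T0 := by exact_mod_cast hT
  have h := (tendsto_Gamma_div_Gamma_mul_rpow (s := (T0 : ℝ) / σ) (by positivity) hΛ).const_mul
    (urnQ T0 σ Λ)
  rw [mul_one] at h
  refine h.congr fun n => ?_
  unfold urnG
  push_cast
  rw [← add_assoc]
  ring

lemma rpow_neg_two_mul {x : ℝ} (hx : 0 < x) (y : ℝ) : x ^ (-(2 * y)) = ((x ^ y) ^ 2)⁻¹ := by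
  rw [Real.rpow_neg hx.le, ← Real.rpow_mul_natCast hx.le, mul_comm y]
  norm_cast

/-! ### Tails of convergent series -/

/-- If `f` is asymptotic to `L` times the decrements of a sequence `u` decreasing to `0`, then the
tail sums of `f` are asymptotic to `L u`. -/
lemma tendsto_tsum_tail_div {f u : ℕ → ℝ} {L : ℝ} (hanti : StrictAnti u)
    (hu0 : Tendsto u atTop (𝓝 0))
    (hf : Tendsto (fun n => f n / (u n - u (n + 1))) atTop (𝓝 L)) :
    Tendsto (fun n => (∑' i, f (n + i)) / u n) atTop (𝓝 L) := by
  have hd : ∀ n, 0 < u n - u (n + 1) := fun n => sub_pos.2 (hanti n.lt_succ_self)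
  have hupos : ∀ n, 0 < u n := fun n =>
    (hanti.antitone.le_of_tendsto hu0 (n + 1)).trans_lt (hanti n.lt_succ_self)
  have hsum : ∀ n, HasSum (fun i => u (n + i) - u (n + i + 1)) (u n) := by
    intro n
    rw [hasSum_iff_tendsto_nat_of_nonneg fun i => (hd _).le]
    have : ∀ k, ∑ i ∈ Finset.range k, (u (n + i) - u (n + i + 1)) = u n - u (n + k) := by
      intro k
      simpa [add_assoc] using Finset.sum_range_sub' (fun i => u (n + i)) k
    simp_rw [this]
    have h2 : Tendsto (fun k => u (n + k)) atTop (𝓝 0) := by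
      simpa [add_comm] using (tendsto_add_atTop_iff_nat n).2 hu0
    simpa using h2.const_sub (u n)
  rw [Metric.tendsto_atTop] at hf ⊢
  intro ε hε
  obtain ⟨N, hN⟩ := hf (ε / 2) (by positivity)
  refine ⟨N, fun n hn => ?_⟩
  have hb : ∀ i, ‖f (n + i) - L * (u (n + i) - u (n + i + 1))‖ ≤
      ε / 2 * (u (n + i) - u (n + i + 1)) := by
    intro i
    have h := hN (n + i) (by omega)
    rw [Real.dist_eq] at h
    have hdi := hd (n + i)
    have : f (n + i) - L * (u (n + i) - u (n + i + 1)) =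
        (f (n + i) / (u (n + i) - u (n + i + 1)) - L) * (u (n + i) - u (n + i + 1)) := by
      field_simp
    rw [this, Real.norm_eq_abs, abs_mul, abs_of_pos hdi]
    gcongr
  have hs1 : Summable fun i => f (n + i) - L * (u (n + i) - u (n + i + 1)) :=
    Summable.of_norm_bounded ((hsum n).summable.mul_left _) hb
  have hsL := (hsum n).mul_left L
  have hle := tsum_of_norm_bounded ((hsum n).mul_left (ε / 2)) hb
  have hsf : ∑' i, f (n + i) =
      (∑' i, (f (n + i) - L * (u (n + i) - u (n + i + 1)))) + L * u n := by
    rw [← hsL.tsum_eq, ← hs1.tsum_add hsL.summable]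
    simp
  have hun := hupos n
  rw [Real.dist_eq, hsf, add_div, mul_div_cancel_right₀ _ hun.ne', add_sub_cancel_right, abs_div,
    abs_of_pos hun, div_lt_iff₀ hun]
  rw [Real.norm_eq_abs] at hle
  nlinarith

lemma tendsto_rpow_sub_rpow_succ_div {p : ℝ} :
    Tendsto (fun n : ℕ => ((n : ℝ) ^ (-p) - ((n : ℝ) + 1) ^ (-p)) / (n : ℝ) ^ (-(p + 1))) atTop
      (𝓝 p) := by
  have hder : HasDerivAt (fun x : ℝ => (1 + x) ^ (-p)) (-p) 0 := by
    have := ((hasDerivAt_id (0 : ℝ)).const_add 1).rpow_const (p := -p) (Or.inl (by simp))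
    simpa using this
  have h := (hasDerivAt_iff_tendsto_slope_zero.1 hder).comp
    ((tendsto_inv_atTop_nhdsGT_zero.mono_right
      (nhdsWithin_mono _ fun x (hx : 0 < x) => hx.ne')).comp tendsto_natCast_atTop_atTop)
  have h' := h.neg
  rw [neg_neg] at h'
  refine h'.congr' ?_
  filter_upwards [eventually_gt_atTop 0] with n hn
  have hn' : (0 : ℝ) < n := by exact_mod_cast hn
  have h1 : (n : ℝ) ^ (-p) ≠ 0 := (Real.rpow_pos_of_pos hn' _).ne'
  have h2 : (n : ℝ) + 1 = n * (1 + (n : ℝ)⁻¹) := by field_simp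
  rw [h2, Real.mul_rpow hn'.le (by positivity), neg_add, Real.rpow_add hn', Real.rpow_neg_one]
  simp only [Function.comp, smul_eq_mul, add_zero, zero_add, Real.one_rpow, inv_inv]
  field_simp
  ring

/-- If `f i ~ c i ^ (-(p + 1))`, then `∑_{i ≥ n} f i ~ (c / p) n ^ (-p)`. -/
lemma tendsto_tsum_tail_div_rpow {f : ℕ → ℝ} {c p : ℝ} (hp : 0 < p)
    (hf : Tendsto (fun n : ℕ => f n / (n : ℝ) ^ (-(p + 1))) atTop (𝓝 c)) :
    Tendsto (fun n : ℕ => (∑' i, f (n + i)) / (n : ℝ) ^ (-p)) atTop (𝓝 (c / p)) := by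
  rw [← tendsto_add_atTop_iff_nat 1]
  set u : ℕ → ℝ := fun n => ((n : ℝ) + 1) ^ (-p) with hu
  have hanti : StrictAnti u := strictAnti_nat_of_succ_lt fun n => by
    simp only [hu]
    exact Real.rpow_lt_rpow_of_neg (by positivity) (by push_cast; linarith) (by linarith)
  have hu0 : Tendsto u atTop (𝓝 0) :=
    (tendsto_rpow_neg_atTop hp).comp
      (tendsto_atTop_add_const_right _ _ tendsto_natCast_atTop_atTop)
  have h1 := hf.div (tendsto_rpow_sub_rpow_succ_div (p := p)) hp.ne'
  have h2 := (tendsto_add_atTop_iff_nat 1).2 h1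
  have := tendsto_tsum_tail_div (f := fun n => f (n + 1)) hanti hu0 (h2.congr fun n => ?_)
  · refine this.congr fun n => ?_
    simp only [hu]
    push_cast
    congr 2
    ext i
    congr 1
    ring
  · have h0 : ((n + 1 : ℕ) : ℝ) ^ (-(p + 1)) ≠ 0 :=
      (Real.rpow_pos_of_pos (by positivity) _).ne'
    simp only [hu, Pi.div_apply]
    rw [div_div_div_cancel_right₀ h0]
    push_cast
    rfl

/-! ### Moments of the sampling distributions -/

lemma sum_range_choose_mul_choose (w b m : ℕ) :
    ∑ k ∈ Finset.range (m + 1), (w.choose k * b.choose (m - k) : ℝ) = ((w + b).choose m : ℝ) := by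
  rw [Nat.add_choose_eq, Finset.Nat.sum_antidiagonal_eq_sum_range_succ
    (fun i j => w.choose i * b.choose j)]
  push_cast
  rfl

/-- First moment, as an absorption identity for an arbitrary weight. -/
lemma sum_range_mul_choose_mul_choose (w b m : ℕ) (f : ℕ → ℝ) :
    ∑ k ∈ Finset.range (m + 2), (k : ℝ) * f k * ((w + 1).choose k * b.choose (m + 1 - k) : ℝ) =
      (w + 1) * ∑ k ∈ Finset.range (m + 1), f (k + 1) * (w.choose k * b.choose (m - k) : ℝ) := by
  rw [Finset.sum_range_succ', Finset.mul_sum]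
  simp only [Nat.cast_zero, zero_mul, add_zero]
  refine Finset.sum_congr rfl fun k _ => ?_
  have h : ((w : ℝ) + 1) * w.choose k = (w + 1).choose (k + 1) * (k + 1) := by
    exact_mod_cast Nat.add_one_mul_choose_eq w k
  rw [Nat.add_sub_add_right]
  push_cast
  linear_combination (-f (k + 1) * b.choose (m - k)) * h

lemma sum_range_cast_mul_choose_mul_choose (w b m : ℕ) :
    (∑ k ∈ Finset.range (m + 1), (k : ℝ) * (w.choose k * b.choose (m - k) : ℝ)) * (w + b : ℝ) =
      w * m * ((w + b).choose m : ℝ) := by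
  rcases m with _ | m
  · simp
  rcases w with _ | w
  · have : ∑ k ∈ Finset.range (m + 1 + 1), (k : ℝ) *
        ((0 : ℕ).choose k * b.choose (m + 1 - k) : ℝ) = 0 :=
      Finset.sum_eq_zero fun k _ => by rcases k with _ | k <;> simp
    rw [this]
    simp
  · have h := sum_range_mul_choose_mul_choose w b m (fun _ => 1)
    simp only [mul_one, one_mul] at h
    rw [h, sum_range_choose_mul_choose]
    have h2 : ((w : ℝ) + b + 1) * (w + b).choose m = (w + 1 + b).choose (m + 1) * (m + 1) := by
      rw [add_right_comm w 1 b]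
      exact_mod_cast Nat.add_one_mul_choose_eq (w + b) m
    push_cast
    linear_combination (w + 1) * h2

lemma sum_range_factorial_two_choose_mul_choose (w b m : ℕ) :
    (∑ k ∈ Finset.range (m + 1), (k : ℝ) * (k - 1) * (w.choose k * b.choose (m - k) : ℝ)) *
        ((w + b) * (w + b - 1) : ℝ) =
      w * (w - 1) * m * (m - 1) * ((w + b).choose m : ℝ) := by
  rcases m with _ | m
  · simp
  rcases w with _ | w
  · have : ∑ k ∈ Finset.range (m + 1 + 1), (k : ℝ) * (k - 1) *
        ((0 : ℕ).choose k * b.choose (m + 1 - k) : ℝ) = 0 :=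
      Finset.sum_eq_zero fun k _ => by rcases k with _ | k <;> simp
    rw [this]
    simp
  · rw [sum_range_mul_choose_mul_choose w b m (fun k => (k : ℝ) - 1)]
    have h1 := sum_range_cast_mul_choose_mul_choose w b m
    have h2 : ((w : ℝ) + b + 1) * (w + b).choose m = (w + 1 + b).choose (m + 1) * (m + 1) := by
      rw [add_right_comm w 1 b]
      exact_mod_cast Nat.add_one_mul_choose_eq (w + b) m
    push_cast
    simp only [add_sub_cancel_right]
    linear_combination (w + 1) * (w + b + 1) * h1 + w * m * (w + 1) * h2

/-- Probability of drawing `k` white balls in either sampling model. -/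
def sampleProb (mdlM : Bool) (m k w b : ℕ) : ℝ :=
  if mdlM then sampleProbM m k w b else sampleProbR m k w b

/-- The ratio between the sampling variance and the binomial variance, for an urn of `T` balls. -/
def varFactor (mdlM : Bool) (m : ℕ) (T : ℝ) : ℝ :=
  if mdlM then (T - m) / (T - 1) else 1

lemma sampleProbR_eq_bernstein {m k w b : ℕ} (hk : k ≤ m) (hT : 0 < w + b) :
    sampleProbR m k w b = (bernsteinPolynomial ℝ m k).eval ((w : ℝ) / (w + b)) := by
  have h : (0 : ℝ) < w + b := by exact_mod_cast hT
  have h1 : 1 - (w : ℝ) / (w + b) = b / (w + b) := by field_simp; ring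
  obtain ⟨j, rfl⟩ := Nat.exists_eq_add_of_le hk
  simp only [bernsteinPolynomial, sampleProbR, Polynomial.eval_mul, Polynomial.eval_pow,
    Polynomial.eval_X, Polynomial.eval_sub, Polynomial.eval_one, Polynomial.eval_natCast, h1,
    div_pow, Nat.add_sub_cancel_left, pow_add]
  field_simp

lemma sum_sampleProb_eq_one {mdlM : Bool} {m w b : ℕ} (hT : 0 < w + b)
    (hfit : (if mdlM then m else 1) ≤ w + b) :
    ∑ k ∈ Finset.range (m + 1), sampleProb mdlM m k w b = 1 := by
  cases mdlM
  · simp only [sampleProb, Bool.false_eq_true, if_false]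
    rw [Finset.sum_congr rfl fun k hk =>
      sampleProbR_eq_bernstein (Nat.lt_succ_iff.1 (Finset.mem_range.1 hk)) hT,
      ← Polynomial.eval_finsetSum, bernsteinPolynomial.sum, Polynomial.eval_one]
  · simp only [if_true] at hfit
    simp only [sampleProb, if_true, sampleProbM]
    rw [← Finset.sum_div, sum_range_choose_mul_choose, div_self]
    exact_mod_cast (Nat.choose_pos hfit).ne'

lemma sum_mul_sampleProb {mdlM : Bool} {m w b : ℕ} (hT : 0 < w + b)
    (hfit : (if mdlM then m else 1) ≤ w + b) :
    ∑ k ∈ Finset.range (m + 1), (k : ℝ) * sampleProb mdlM m k w b = m * (w / (w + b)) := by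
  have h : (0 : ℝ) < w + b := by exact_mod_cast hT
  cases mdlM
  · have := congrArg (Polynomial.eval ((w : ℝ) / (w + b))) (bernsteinPolynomial.sum_smul ℝ m)
    rw [Polynomial.eval_finsetSum] at this
    simp only [nsmul_eq_mul, Polynomial.eval_mul, Polynomial.eval_natCast, Polynomial.eval_X]
      at this
    rw [← this]
    refine Finset.sum_congr rfl fun k hk => ?_
    simp only [sampleProb, Bool.false_eq_true, if_false]
    rw [sampleProbR_eq_bernstein (Nat.lt_succ_iff.1 (Finset.mem_range.1 hk)) hT]
  · simp only [if_true] at hfit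
    have hC : (0 : ℝ) < (w + b).choose m := by exact_mod_cast Nat.choose_pos hfit
    simp only [sampleProb, if_true, sampleProbM, ← mul_div_assoc]
    rw [← Finset.sum_div, div_eq_div_iff hC.ne' h.ne', sum_range_cast_mul_choose_mul_choose]
    ring

lemma sum_sub_mean_mul_sampleProb {mdlM : Bool} {m w b : ℕ} (hT : 0 < w + b)
    (hfit : (if mdlM then m else 1) ≤ w + b) :
    ∑ k ∈ Finset.range (m + 1), ((k : ℝ) - m * (w / (w + b))) * sampleProb mdlM m k w b = 0 := by
  simp only [sub_mul, Finset.sum_sub_distrib, ← Finset.mul_sum]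
  rw [sum_mul_sampleProb hT hfit, sum_sampleProb_eq_one hT hfit]
  ring

lemma sum_sq_sub_mean_mul_sampleProb {mdlM : Bool} {m w b : ℕ} (hT : 2 ≤ w + b)
    (hfit : (if mdlM then m else 1) ≤ w + b) :
    ∑ k ∈ Finset.range (m + 1), ((k : ℝ) - m * (w / (w + b))) ^ 2 * sampleProb mdlM m k w b =
      m * (w / (w + b)) * (1 - w / (w + b)) * varFactor mdlM m (w + b) := by
  have h2 : (2 : ℝ) ≤ w + b := by exact_mod_cast hT
  have hT0 : 0 < w + b := by omega
  cases mdlM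
  · have := congrArg (Polynomial.eval ((w : ℝ) / (w + b))) (bernsteinPolynomial.variance ℝ m)
    rw [Polynomial.eval_finsetSum] at this
    simp only [nsmul_eq_mul, Polynomial.eval_mul, Polynomial.eval_natCast, Polynomial.eval_X,
      Polynomial.eval_pow, Polynomial.eval_sub, Polynomial.eval_one] at this
    simp only [varFactor, Bool.false_eq_true, if_false, mul_one]
    rw [← this]
    refine Finset.sum_congr rfl fun k hk => ?_
    simp only [sampleProb, Bool.false_eq_true, if_false]
    rw [sampleProbR_eq_bernstein (Nat.lt_succ_iff.1 (Finset.mem_range.1 hk)) hT0]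
    ring
  · have hs0 := sum_sampleProb_eq_one hT0 hfit
    have hs1 := sum_mul_sampleProb hT0 hfit
    have hs2 : ∑ k ∈ Finset.range (m + 1), (k : ℝ) * (k - 1) * sampleProb true m k w b =
        w * (w - 1) * m * (m - 1) / ((w + b) * (w + b - 1)) := by
      simp only [if_true] at hfit
      have hC : (0 : ℝ) < (w + b).choose m := by exact_mod_cast Nat.choose_pos hfit
      have hne : ((w + b) * (w + b - 1) : ℝ) ≠ 0 :=
        mul_ne_zero (by linarith) (by linarith)
      simp only [sampleProb, if_true, sampleProbM, ← mul_div_assoc]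
      rw [← Finset.sum_div, div_eq_div_iff hC.ne' hne,
        sum_range_factorial_two_choose_mul_choose]
    have hexp : ∀ k : ℕ, ((k : ℝ) - m * (w / (w + b))) ^ 2 * sampleProb true m k w b =
        k * (k - 1) * sampleProb true m k w b
          + (1 - 2 * (m * (w / (w + b)))) * (k * sampleProb true m k w b)
          + (m * (w / (w + b))) ^ 2 * sampleProb true m k w b := fun k => by ring
    simp only [hexp, Finset.sum_add_distrib, ← Finset.mul_sum, hs0, hs1, hs2, varFactor, if_true]
    have e1 : (w + b : ℝ) ≠ 0 := by linarith
    have e2 : (w + b - 1 : ℝ) ≠ 0 := by linarith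
    field_simp
    ring

/-! ### The draw process -/

section Urn

variable {Ω : Type*} {m0 : MeasurableSpace Ω} {μ : Measure Ω} {mdlM : Bool} {m : ℕ}
  {a b : ℕ → ℤ} {σ : ℤ} {W0 B0 : ℕ} {W B R : ℕ → Ω → ℕ} {F : Filtration ℕ m0}

namespace UrnScheme

lemma total (hurn : UrnScheme μ mdlM m a b σ W0 B0 W B R F) (n : ℕ) (ω : Ω) :
    (W n ω : ℤ) + B n ω = W0 + B0 + σ * n := by
  induction n with
  | zero => simp [hurn.initW, hurn.initB]
  | succ n ih =>
    have := hurn.balanced (m - R (n + 1) ω) (Nat.sub_le _ _)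
    rw [hurn.dynW, hurn.dynB]
    push_cast
    linear_combination ih + this

lemma total_real (hurn : UrnScheme μ mdlM m a b σ W0 B0 W B R F) (n : ℕ) (ω : Ω) :
    (W n ω : ℝ) + B n ω = ((W0 + B0 : ℕ) : ℝ) + σ * n := by
  push_cast
  exact_mod_cast hurn.total n ω

lemma total_pos (hurn : UrnScheme μ mdlM m a b σ W0 B0 W B R F) (n : ℕ) (ω : Ω) :
    0 < W n ω + B n ω := by
  have h1 := hurn.sampleFit n ω
  have h2 := hurn.hm
  split_ifs at h1 <;> omega

lemma initial_pos [Nonempty Ω] (hurn : UrnScheme μ mdlM m a b σ W0 B0 W B R F) :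
    0 < W0 + B0 := by
  obtain ⟨ω⟩ := ‹Nonempty Ω›
  simpa [hurn.initW, hurn.initB] using hurn.total_pos 0 ω

lemma white_le (hurn : UrnScheme μ mdlM m a b σ W0 B0 W B R F) (n : ℕ) (ω : Ω) :
    W n ω ≤ (W0 + B0 + σ * n).toNat := by
  have := hurn.total n ω
  omega

lemma white_ratio_mem (hurn : UrnScheme μ mdlM m a b σ W0 B0 W B R F) (n : ℕ) (ω : Ω) :
    (W n ω : ℝ) / (((W0 + B0 : ℕ) : ℝ) + σ * n) ∈ Icc (0 : ℝ) 1 := by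
  have h : (0 : ℝ) < W n ω + B n ω := by exact_mod_cast hurn.total_pos n ω
  rw [← hurn.total_real n ω]
  refine ⟨by positivity, (div_le_one h).2 ?_⟩
  have : (0 : ℝ) ≤ B n ω := Nat.cast_nonneg _
  linarith

lemma measurable_draw (hurn : UrnScheme μ mdlM m a b σ W0 B0 W B R F) (n : ℕ)
    (φ : ℕ → ℕ → ℝ) : Measurable fun ω => φ (R (n + 1) ω) (W n ω) :=
  (Measurable.of_discrete (f := fun q : ℕ × ℕ => φ q.1 q.2)).comp
    (((hurn.measR n).mono (F.le _) le_rfl).prodMk ((hurn.measW n).mono (F.le _) le_rfl))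

lemma stronglyMeasurable_white (hurn : UrnScheme μ mdlM m a b σ W0 B0 W B R F) (n : ℕ)
    (f : ℕ → ℝ) : StronglyMeasurable[F n] fun ω => f (W n ω) :=
  ((Measurable.of_discrete (f := f)).comp (hurn.measW n)).stronglyMeasurable

lemma integrable_draw [IsFiniteMeasure μ] (hurn : UrnScheme μ mdlM m a b σ W0 B0 W B R F)
    (n : ℕ) (φ : ℕ → ℕ → ℝ) : Integrable (fun ω => φ (R (n + 1) ω) (W n ω)) μ := by
  set N := (W0 + B0 + σ * n).toNat
  refine Integrable.of_bound (hurn.measurable_draw n φ).aestronglyMeasurable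
    (∑ k ∈ Finset.range (m + 1), ∑ w ∈ Finset.range (N + 1), ‖φ k w‖) (ae_of_all _ fun ω => ?_)
  have h1 : R (n + 1) ω ∈ Finset.range (m + 1) :=
    Finset.mem_range.2 (Nat.lt_succ_iff.2 (hurn.sampleLe n ω))
  have h2 : W n ω ∈ Finset.range (N + 1) :=
    Finset.mem_range.2 (Nat.lt_succ_iff.2 (hurn.white_le n ω))
  calc ‖φ (R (n + 1) ω) (W n ω)‖
      ≤ ∑ w ∈ Finset.range (N + 1), ‖φ (R (n + 1) ω) w‖ :=
        Finset.single_le_sum (f := fun w => ‖φ (R (n + 1) ω) w‖) (fun _ _ => norm_nonneg _) h2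
    _ ≤ _ := Finset.single_le_sum (f := fun k => ∑ w ∈ Finset.range (N + 1), ‖φ k w‖)
        (fun _ _ => Finset.sum_nonneg fun _ _ => norm_nonneg _) h1

/-- Conditional expectation of a function of the current state and the next sample. -/
lemma condExp_draw [IsFiniteMeasure μ] (hurn : UrnScheme μ mdlM m a b σ W0 B0 W B R F)
    (n : ℕ) (φ : ℕ → ℕ → ℝ) :
    μ[fun ω => φ (R (n + 1) ω) (W n ω) | F n] =ᵐ[μ] fun ω =>
      ∑ k ∈ Finset.range (m + 1), φ k (W n ω) * sampleProb mdlM m k (W n ω) (B n ω) := by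
  set I : ℕ → Ω → ℝ := fun k => ({ω | R (n + 1) ω = k}).indicator fun _ => (1 : ℝ) with hI
  have hIR : ∀ k, I k = fun ω => if R (n + 1) ω = k then 1 else 0 := fun k => by
    ext ω
    simp [hI, indicator_apply]
  have e : (fun ω => φ (R (n + 1) ω) (W n ω)) =
      ∑ k ∈ Finset.range (m + 1), (fun ω => φ k (W n ω)) * I k := by
    ext ω
    have h1 : R (n + 1) ω < m + 1 := Nat.lt_succ_iff.2 (hurn.sampleLe n ω)
    simp [Finset.sum_apply, hIR, h1]
  have hInt : ∀ k, Integrable (I k) μ := fun k => by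
    rw [hIR]
    exact hurn.integrable_draw n fun r _ => if r = k then 1 else 0
  have hInt' : ∀ k, Integrable ((fun ω => φ k (W n ω)) * I k) μ := fun k => by
    rw [hIR]
    exact hurn.integrable_draw n fun r w => φ k w * if r = k then 1 else 0
  have hk : ∀ k ∈ Finset.range (m + 1), ∀ᵐ ω ∂μ, (μ[(fun ω => φ k (W n ω)) * I k | F n]) ω =
      φ k (W n ω) * sampleProb mdlM m k (W n ω) (B n ω) := fun k hk => by
    filter_upwards [condExp_mul_of_stronglyMeasurable_left
      (hurn.stronglyMeasurable_white n (φ k)) (hInt' k) (hInt k),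
      hurn.condLaw n k (Nat.lt_succ_iff.1 (Finset.mem_range.1 hk))] with ω h1 h2
    rw [h1, Pi.mul_apply, h2, sampleProb]
  rw [e]
  filter_upwards [condExp_finsetSum (fun k _ => hInt' k) (F n),
    (Filter.eventually_all_finset _).2 hk] with ω h1 h2
  rw [h1, Finset.sum_apply]
  exact Finset.sum_congr rfl h2

lemma integral_draw [IsFiniteMeasure μ] (hurn : UrnScheme μ mdlM m a b σ W0 B0 W B R F)
    (n : ℕ) (φ : ℕ → ℕ → ℝ) :
    ∫ ω, φ (R (n + 1) ω) (W n ω) ∂μ = ∫ ω, ∑ k ∈ Finset.range (m + 1),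
      φ k (W n ω) * sampleProb mdlM m k (W n ω) (B n ω) ∂μ := by
  rw [← integral_condExp (F.le n)]
  exact integral_congr_ae (hurn.condExp_draw n φ)

end UrnScheme

/-! ### The urn martingale -/

/-- The centred and rescaled number of white balls `g_n (W_n - ζ (n + T₀ / σ))`. -/
def urnMart (m : ℕ) (a : ℕ → ℤ) (σ : ℤ) (T0 : ℕ) (W : ℕ → Ω → ℕ) (n : ℕ) (ω : Ω) : ℝ :=
  urnG T0 σ (urnIndex m a σ) n * ((W n ω : ℝ) - urnZeta m a σ * ((n : ℝ) + (T0 : ℝ) / σ))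

/-- The increment of `urnMart` from time `n` to time `n + 1`, as a function of the next sample
size `r` and the current number `w` of white balls. -/
def urnIncr (m : ℕ) (a : ℕ → ℤ) (σ : ℤ) (T0 n r w : ℕ) : ℝ :=
  urnG T0 σ (urnIndex m a σ) (n + 1) * ((a (m - 1) : ℝ) - a m) *
    ((r : ℝ) - m * ((w : ℝ) / ((T0 : ℝ) + σ * n)))

namespace UrnScheme

lemma sub_eq_index (hurn : UrnScheme μ mdlM m a b σ W0 B0 W B R F) :
    (a (m - 1) : ℝ) - a m = urnIndex m a σ * σ / m := by
  have h1 : (m : ℝ) ≠ 0 := by exact_mod_cast (hurn.hm.trans_lt' one_pos).ne'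
  have h2 : (σ : ℝ) ≠ 0 := by exact_mod_cast (hurn.hσ.trans_lt' one_pos).ne'
  unfold urnIndex
  field_simp

lemma white_succ (hurn : UrnScheme μ mdlM m a b σ W0 B0 W B R F) (n : ℕ) (ω : Ω) :
    (W (n + 1) ω : ℝ) = W n ω + (R (n + 1) ω * ((a (m - 1) : ℝ) - a m) + a m) := by
  have h1 := hurn.dynW n ω
  have h2 := hurn.affine (m - R (n + 1) ω) (Nat.sub_le _ _)
  rw [Nat.cast_sub (hurn.sampleLe n ω)] at h2
  rw [h2] at h1
  have : (W (n + 1) ω : ℤ) = W n ω + (R (n + 1) ω * (a (m - 1) - a m) + a m) := by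
    rw [h1]
    ring
  exact_mod_cast this

lemma sq_urnIncr_le (hurn : UrnScheme μ mdlM m a b σ W0 B0 W B R F) (n : ℕ) (ω : Ω) :
    urnIncr m a σ (W0 + B0) n (R (n + 1) ω) (W n ω) ^ 2 ≤
      (((a (m - 1) : ℝ) - a m) * m) ^ 2 * urnG (W0 + B0) σ (urnIndex m a σ) (n + 1) ^ 2 := by
  have h1 := hurn.white_ratio_mem n ω
  have h2 : (R (n + 1) ω : ℝ) ≤ m := by exact_mod_cast hurn.sampleLe n ω
  have h3 : (0 : ℝ) ≤ R (n + 1) ω := Nat.cast_nonneg _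
  have h4 : (0 : ℝ) ≤ m := Nat.cast_nonneg _
  unfold urnIncr
  set p := (W n ω : ℝ) / (((W0 + B0 : ℕ) : ℝ) + σ * n)
  have h5 : ((R (n + 1) ω : ℝ) - m * p) ^ 2 ≤ (m : ℝ) ^ 2 := by
    have := mul_nonneg h4 h1.1
    have := mul_le_of_le_one_right h4 h1.2
    exact sq_le_sq' (by linarith) (by linarith)
  calc _ = (urnG (W0 + B0) σ (urnIndex m a σ) (n + 1) * ((a (m - 1) : ℝ) - a m)) ^ 2 *
        ((R (n + 1) ω : ℝ) - m * p) ^ 2 := by ring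
    _ ≤ (urnG (W0 + B0) σ (urnIndex m a σ) (n + 1) * ((a (m - 1) : ℝ) - a m)) ^ 2 *
        (m : ℝ) ^ 2 := by gcongr
    _ = _ := by ring

/-- The increment is conditionally centred. -/
lemma sum_urnIncr_mul_sampleProb (hurn : UrnScheme μ mdlM m a b σ W0 B0 W B R F) (n : ℕ)
    (ω : Ω) : ∑ k ∈ Finset.range (m + 1), urnIncr m a σ (W0 + B0) n k (W n ω) *
      sampleProb mdlM m k (W n ω) (B n ω) = 0 := by
  have := sum_sub_mean_mul_sampleProb (hurn.total_pos n ω) (hurn.sampleFit n ω)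
  unfold urnIncr
  rw [← hurn.total_real n ω]
  simp only [mul_assoc] at this ⊢
  rw [← Finset.mul_sum, ← Finset.mul_sum, this, mul_zero, mul_zero]

/-- The conditional variance of the increment. -/
lemma sum_sq_urnIncr_mul_sampleProb (hurn : UrnScheme μ mdlM m a b σ W0 B0 W B R F) {n : ℕ}
    (hn : 0 < n) (ω : Ω) :
    ∑ k ∈ Finset.range (m + 1), urnIncr m a σ (W0 + B0) n k (W n ω) ^ 2 *
      sampleProb mdlM m k (W n ω) (B n ω) =
    urnG (W0 + B0) σ (urnIndex m a σ) (n + 1) ^ 2 * ((a (m - 1) : ℝ) - a m) ^ 2 * m *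
      varFactor mdlM m (((W0 + B0 : ℕ) : ℝ) + σ * n) *
      ((W n ω : ℝ) / (((W0 + B0 : ℕ) : ℝ) + σ * n) *
        (1 - (W n ω : ℝ) / (((W0 + B0 : ℕ) : ℝ) + σ * n))) := by
  have hT2 : 2 ≤ W n ω + B n ω := by
    have h1 := hurn.total n ω
    have h2 := hurn.total_pos 0 ω
    rw [hurn.initW, hurn.initB] at h2
    have h3 : 1 ≤ σ * n := one_le_mul_of_one_le_of_one_le hurn.hσ (by exact_mod_cast hn)
    omega
  have := sum_sq_sub_mean_mul_sampleProb hT2 (hurn.sampleFit n ω)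
  unfold urnIncr
  rw [← hurn.total_real n ω]
  simp only [mul_pow _ ((_ : ℝ) - (m : ℝ) * _), mul_assoc (_ ^ 2) (_ ^ 2) (sampleProb _ _ _ _ _)]
  rw [← Finset.mul_sum, this]
  ring

variable [IsProbabilityMeasure μ]

lemma urnMart_succ (hurn : UrnScheme μ mdlM m a b σ W0 B0 W B R F)
    (hΛ0 : 0 < urnIndex m a σ) (hΛ1 : urnIndex m a σ < 1) (n : ℕ) (ω : Ω) :
    urnMart m a σ (W0 + B0) W (n + 1) ω = urnMart m a σ (W0 + B0) W n ω +
      urnIncr m a σ (W0 + B0) n (R (n + 1) ω) (W n ω) := by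
  have := nonempty_of_isProbabilityMeasure μ
  have hT := hurn.initial_pos
  have hg := urnG_succ_mul hT hurn.hσ hΛ0 n
  have hT' : (0 : ℝ) < ((W0 + B0 : ℕ) : ℝ) := by exact_mod_cast hT
  have hσ : (0 : ℝ) < σ := by exact_mod_cast hurn.hσ
  have hm : (m : ℝ) ≠ 0 := by exact_mod_cast (hurn.hm.trans_lt' one_pos).ne'
  have hx : (0 : ℝ) < (n : ℝ) + ((W0 + B0 : ℕ) : ℝ) / σ := by positivity
  have hTx : ((W0 + B0 : ℕ) : ℝ) + σ * n = σ * ((n : ℝ) + ((W0 + B0 : ℕ) : ℝ) / σ) := by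
    field_simp
    ring
  have hζ : urnZeta m a σ * (1 - urnIndex m a σ) = a m := by
    have : 1 - urnIndex m a σ ≠ 0 := by linarith
    unfold urnZeta
    field_simp
  unfold urnMart urnIncr
  rw [hTx, hurn.white_succ, hurn.sub_eq_index, ← hζ]
  push_cast at hg hx ⊢
  rw [show (n : ℝ) + 1 + ((W0 : ℝ) + B0) / σ = (n + ((W0 : ℝ) + B0) / σ) + 1 by ring]
  set x : ℝ := n + ((W0 : ℝ) + B0) / σ
  have hg' : urnG (W0 + B0) σ (urnIndex m a σ) n =
      urnG (W0 + B0) σ (urnIndex m a σ) (n + 1) * (x + urnIndex m a σ) / x := by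
    rw [hg]
    field_simp
  rw [hg']
  field_simp
  ring

lemma integral_mul_urnIncr (hurn : UrnScheme μ mdlM m a b σ W0 B0 W B R F) (n : ℕ)
    (f : ℕ → ℝ) :
    ∫ ω, f (W n ω) * urnIncr m a σ (W0 + B0) n (R (n + 1) ω) (W n ω) ∂μ = 0 := by
  rw [hurn.integral_draw n fun r w => f w * urnIncr m a σ (W0 + B0) n r w]
  simp only [mul_assoc, ← Finset.mul_sum]
  simp [hurn.sum_urnIncr_mul_sampleProb]

lemma integrable_urnMart (hurn : UrnScheme μ mdlM m a b σ W0 B0 W B R F) (n : ℕ) :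
    Integrable (urnMart m a σ (W0 + B0) W n) μ :=
  hurn.integrable_draw n fun _ w => urnG (W0 + B0) σ (urnIndex m a σ) n *
    ((w : ℝ) - urnZeta m a σ * ((n : ℝ) + ((W0 + B0 : ℕ) : ℝ) / σ))

lemma martingale_urnMart (hurn : UrnScheme μ mdlM m a b σ W0 B0 W B R F)
    (hΛ0 : 0 < urnIndex m a σ) (hΛ1 : urnIndex m a σ < 1) :
    Martingale (urnMart m a σ (W0 + B0) W) F μ := by
  have hadp : ∀ n, StronglyMeasurable[F n] (urnMart m a σ (W0 + B0) W n) := fun n =>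
    hurn.stronglyMeasurable_white n fun w => urnG (W0 + B0) σ (urnIndex m a σ) n *
      ((w : ℝ) - urnZeta m a σ * ((n : ℝ) + ((W0 + B0 : ℕ) : ℝ) / σ))
  refine martingale_nat hadp hurn.integrable_urnMart fun n => ?_
  have e : urnMart m a σ (W0 + B0) W (n + 1) = urnMart m a σ (W0 + B0) W n +
      fun ω => urnIncr m a σ (W0 + B0) n (R (n + 1) ω) (W n ω) :=
    funext fun ω => hurn.urnMart_succ hΛ0 hΛ1 n ω
  rw [e]
  filter_upwards [condExp_add (hurn.integrable_urnMart n)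
    (hurn.integrable_draw n (urnIncr m a σ (W0 + B0) n)) (F n),
    hurn.condExp_draw n (urnIncr m a σ (W0 + B0) n)] with ω h1 h2
  rw [h1, Pi.add_apply, h2, hurn.sum_urnIncr_mul_sampleProb,
    condExp_of_stronglyMeasurable (F.le n) (hadp n) (hurn.integrable_urnMart n), add_zero]

lemma integral_urnMart_succ (hurn : UrnScheme μ mdlM m a b σ W0 B0 W B R F)
    (hΛ0 : 0 < urnIndex m a σ) (hΛ1 : urnIndex m a σ < 1) (n : ℕ) :
    ∫ ω, urnMart m a σ (W0 + B0) W (n + 1) ω ∂μ = ∫ ω, urnMart m a σ (W0 + B0) W n ω ∂μ := by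
  simp only [hurn.urnMart_succ hΛ0 hΛ1]
  rw [integral_add (hurn.integrable_urnMart n)
    (hurn.integrable_draw n (urnIncr m a σ (W0 + B0) n))]
  have := hurn.integral_mul_urnIncr n fun _ => 1
  simp only [one_mul] at this
  rw [this, add_zero]

lemma integral_sq_urnMart_succ (hurn : UrnScheme μ mdlM m a b σ W0 B0 W B R F)
    (hΛ0 : 0 < urnIndex m a σ) (hΛ1 : urnIndex m a σ < 1) (n : ℕ) :
    ∫ ω, urnMart m a σ (W0 + B0) W (n + 1) ω ^ 2 ∂μ =
      ∫ ω, urnMart m a σ (W0 + B0) W n ω ^ 2 ∂μ +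
        ∫ ω, urnIncr m a σ (W0 + B0) n (R (n + 1) ω) (W n ω) ^ 2 ∂μ := by
  set M : ℕ → ℝ := fun w => urnG (W0 + B0) σ (urnIndex m a σ) n *
    ((w : ℝ) - urnZeta m a σ * ((n : ℝ) + ((W0 + B0 : ℕ) : ℝ) / σ))
  have hM : ∀ ω, urnMart m a σ (W0 + B0) W n ω = M (W n ω) := fun ω => rfl
  simp only [hurn.urnMart_succ hΛ0 hΛ1, hM]
  have hcross := hurn.integral_mul_urnIncr n fun w => 2 * M w
  have e : ∀ ω, (M (W n ω) + urnIncr m a σ (W0 + B0) n (R (n + 1) ω) (W n ω)) ^ 2 =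
      M (W n ω) ^ 2 + 2 * M (W n ω) * urnIncr m a σ (W0 + B0) n (R (n + 1) ω) (W n ω) +
        urnIncr m a σ (W0 + B0) n (R (n + 1) ω) (W n ω) ^ 2 := fun ω => by ring
  have i1 := hurn.integrable_draw n fun _ w => M w ^ 2
  have i2 := hurn.integrable_draw n fun r w => 2 * M w * urnIncr m a σ (W0 + B0) n r w
  have i3 := hurn.integrable_draw n fun r w => urnIncr m a σ (W0 + B0) n r w ^ 2
  simp only [e]
  have h12 := integral_add i1 i2
  rw [hcross, add_zero] at h12
  rw [← h12]
  exact integral_add (i1.add i2) i3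

end UrnScheme

lemma summable_sq_urnG_succ {T0 : ℕ} {Λ : ℝ} (hT : 0 < T0) (hσ : 1 ≤ σ) (hΛ : 1 / 2 < Λ) :
    Summable fun n : ℕ => urnG T0 σ Λ (n + 1) ^ 2 := by
  have h := (tendsto_urnG_succ_mul_rpow hT hσ (by linarith : 0 < Λ)).pow 2
  refine summable_of_isBigO_nat (Real.summable_nat_rpow.2 (by linarith : -(2 * Λ) < -1)) ?_
  refine Asymptotics.isBigO_of_div_tendsto_nhds ?_ _ (h.congr' ?_)
  · filter_upwards [eventually_gt_atTop 0] with n hn h0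
    have hn' : (0 : ℝ) < n := by exact_mod_cast hn
    exact absurd h0 (Real.rpow_pos_of_pos hn' _).ne'
  · filter_upwards [eventually_gt_atTop 0] with n hn
    have hn' : (0 : ℝ) < n := by exact_mod_cast hn
    simp only [Pi.div_apply]
    rw [rpow_neg_two_mul hn', div_inv_eq_mul, mul_pow]

lemma tendsto_urnG_mul_atTop {T0 : ℕ} {Λ : ℝ} (hT : 0 < T0) (hσ : 1 ≤ σ) (hΛ0 : 0 < Λ)
    (hΛ1 : Λ < 1) :
    Tendsto (fun n : ℕ => urnG T0 σ Λ n * ((n : ℝ) + (T0 : ℝ) / σ)) atTop atTop := by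
  have h := (tendsto_urnG_succ_mul_rpow hT hσ hΛ0).pos_mul_atTop (urnQ_pos hT hσ hΛ0)
    ((tendsto_rpow_atTop (sub_pos.2 hΛ1)).comp tendsto_natCast_atTop_atTop)
  refine tendsto_atTop_mono' _ ?_ h
  filter_upwards [eventually_gt_atTop 0] with n hn
  have hn' : (0 : ℝ) < n := by exact_mod_cast hn
  have hσ' : (0 : ℝ) < σ := by exact_mod_cast hσ
  rw [← urnG_succ_mul hT hσ hΛ0, mul_assoc, Function.comp_apply, ← Real.rpow_add hn',
    add_sub_cancel, Real.rpow_one]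
  have := urnG_pos hT hσ hΛ0 (n + 1)
  gcongr
  have : (0 : ℝ) ≤ (T0 : ℝ) / σ := by positivity
  linarith

namespace UrnScheme

variable [IsProbabilityMeasure μ]

lemma exists_integral_sq_urnMart_le (hurn : UrnScheme μ mdlM m a b σ W0 B0 W B R F)
    (hΛ0 : 1 / 2 < urnIndex m a σ) (hΛ1 : urnIndex m a σ < 1) :
    ∃ C, ∀ n, ∫ ω, urnMart m a σ (W0 + B0) W n ω ^ 2 ∂μ ≤ C := by
  have := nonempty_of_isProbabilityMeasure μ
  set c : ℕ → ℝ := fun n =>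
    (((a (m - 1) : ℝ) - a m) * m) ^ 2 * urnG (W0 + B0) σ (urnIndex m a σ) (n + 1) ^ 2
  have hc : Summable c := (summable_sq_urnG_succ hurn.initial_pos hurn.hσ hΛ0).mul_left _
  have hc0 : ∀ n, 0 ≤ c n := fun n => by positivity
  refine ⟨∫ ω, urnMart m a σ (W0 + B0) W 0 ω ^ 2 ∂μ + ∑' n, c n, fun n => ?_⟩
  suffices h : ∫ ω, urnMart m a σ (W0 + B0) W n ω ^ 2 ∂μ ≤
      ∫ ω, urnMart m a σ (W0 + B0) W 0 ω ^ 2 ∂μ + ∑ i ∈ Finset.range n, c i by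
    have := hc.sum_le_tsum (Finset.range n) fun i _ => hc0 i
    linarith
  induction n with
  | zero => simp
  | succ n ih =>
    rw [hurn.integral_sq_urnMart_succ (by linarith) hΛ1, Finset.sum_range_succ]
    have : ∫ ω, urnIncr m a σ (W0 + B0) n (R (n + 1) ω) (W n ω) ^ 2 ∂μ ≤ ∫ _, c n ∂μ :=
      integral_mono (hurn.integrable_draw n fun r w => urnIncr m a σ (W0 + B0) n r w ^ 2)
        (integrable_const _) fun ω => hurn.sq_urnIncr_le n ω
    simp only [integral_const, probReal_univ, one_smul] at this
    linarith

/-- The martingale `urnMart` converges almost surely. -/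
lemma ae_exists_tendsto_urnMart (hurn : UrnScheme μ mdlM m a b σ W0 B0 W B R F)
    (hΛ0 : 1 / 2 < urnIndex m a σ) (hΛ1 : urnIndex m a σ < 1) :
    ∀ᵐ ω ∂μ, ∃ c, Tendsto (fun n => urnMart m a σ (W0 + B0) W n ω) atTop (𝓝 c) := by
  obtain ⟨C, hC⟩ := hurn.exists_integral_sq_urnMart_le hΛ0 hΛ1
  refine (hurn.martingale_urnMart (by linarith) hΛ1).submartingale.exists_ae_tendsto_of_bdd
    (R := (1 + C).toNNReal) fun n => ?_
  have hInt := hurn.integrable_urnMart n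
  have hsq : Integrable (fun ω => urnMart m a σ (W0 + B0) W n ω ^ 2) μ :=
    hurn.integrable_draw n fun _ w => (urnG (W0 + B0) σ (urnIndex m a σ) n *
      ((w : ℝ) - urnZeta m a σ * ((n : ℝ) + ((W0 + B0 : ℕ) : ℝ) / σ))) ^ 2
  rw [eLpNorm_one_eq_lintegral_enorm, ← ofReal_integral_norm_eq_lintegral_enorm hInt]
  refine ENNReal.ofReal_le_ofReal ?_
  calc ∫ ω, ‖urnMart m a σ (W0 + B0) W n ω‖ ∂μ
      ≤ ∫ ω, (1 + urnMart m a σ (W0 + B0) W n ω ^ 2) ∂μ := by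
        refine integral_mono hInt.norm ((integrable_const _).add hsq) fun ω => ?_
        simp only [Real.norm_eq_abs]
        nlinarith [sq_nonneg (|urnMart m a σ (W0 + B0) W n ω| - 1),
          sq_abs (urnMart m a σ (W0 + B0) W n ω), abs_nonneg (urnMart m a σ (W0 + B0) W n ω)]
    _ = 1 + ∫ ω, urnMart m a σ (W0 + B0) W n ω ^ 2 ∂μ := by
        rw [integral_add (integrable_const _) hsq]
        simp
    _ ≤ 1 + C := by linarith [hC n]

/-- The proportion of white balls converges almost surely to `ζ / σ`. -/
lemma ae_tendsto_white_ratio (hurn : UrnScheme μ mdlM m a b σ W0 B0 W B R F)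
    (hΛ0 : 1 / 2 < urnIndex m a σ) (hΛ1 : urnIndex m a σ < 1) :
    ∀ᵐ ω ∂μ, Tendsto (fun n : ℕ => (W n ω : ℝ) / (((W0 + B0 : ℕ) : ℝ) + σ * n)) atTop
      (𝓝 (urnZeta m a σ / σ)) := by
  have := nonempty_of_isProbabilityMeasure μ
  have hT := hurn.initial_pos
  have hΛ : 0 < urnIndex m a σ := by linarith
  have hT' : (0 : ℝ) < ((W0 + B0 : ℕ) : ℝ) := by exact_mod_cast hT
  have hσ : (0 : ℝ) < σ := by exact_mod_cast hurn.hσ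
  filter_upwards [hurn.ae_exists_tendsto_urnMart hΛ0 hΛ1] with ω ⟨c, hc⟩
  have h := ((hc.div_atTop (tendsto_urnG_mul_atTop hT hurn.hσ hΛ hΛ1)).div_const
    (σ : ℝ)).add_const (urnZeta m a σ / σ)
  rw [zero_div, zero_add] at h
  refine h.congr fun n => ?_
  have hx : (0 : ℝ) < (n : ℝ) + ((W0 + B0 : ℕ) : ℝ) / σ := by positivity
  have hTx : ((W0 + B0 : ℕ) : ℝ) + σ * n = σ * ((n : ℝ) + ((W0 + B0 : ℕ) : ℝ) / σ) := by
    field_simp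
    ring
  have hg := urnG_pos hT hurn.hσ hΛ n
  unfold urnMart
  rw [hTx]
  set x := (n : ℝ) + ((W0 + B0 : ℕ) : ℝ) / σ
  field_simp
  ring

/-- The martingale differences `calX` are the increments `urnIncr`. -/
lemma calX_succ (hurn : UrnScheme μ mdlM m a b σ W0 B0 W B R F)
    (hΛ0 : 0 < urnIndex m a σ) (hΛ1 : urnIndex m a σ < 1) (n : ℕ) (ω : Ω) :
    calX μ σ (urnIndex m a σ) (W0 + B0) W (n + 1) ω =
      urnIncr m a σ (W0 + B0) n (R (n + 1) ω) (W n ω) := by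
  have hW : ∀ k, calW μ σ (urnIndex m a σ) (W0 + B0) W k ω =
      urnMart m a σ (W0 + B0) W k ω - ∫ ω', urnMart m a σ (W0 + B0) W k ω' ∂μ := fun k => by
    unfold calW urnMart
    rw [integral_const_mul, integral_sub (hurn.integrable_draw k fun _ w => (w : ℝ))
      (integrable_const _)]
    simp only [integral_const, probReal_univ, one_smul]
    ring
  rw [calX, hW, hW, Nat.add_sub_cancel, hurn.integral_urnMart_succ hΛ0 hΛ1,
    hurn.urnMart_succ hΛ0 hΛ1]
  ring

end UrnScheme

lemma tendsto_varFactor {T0 : ℝ} (hσ : 1 ≤ σ) :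
    Tendsto (fun n : ℕ => varFactor mdlM m (T0 + σ * n)) atTop (𝓝 1) := by
  cases mdlM
  · simp [varFactor]
  · have hσ' : (0 : ℝ) < σ := by exact_mod_cast hσ
    have hT : Tendsto (fun n : ℕ => T0 + σ * n - 1) atTop atTop :=
      tendsto_atTop_add_const_right _ _ (tendsto_atTop_add_const_left _ _
        (tendsto_natCast_atTop_atTop.const_mul_atTop hσ'))
    have h := (hT.const_div_atTop (1 - (m : ℝ))).const_add 1
    rw [add_zero] at h
    refine h.congr' ?_
    filter_upwards [hT.eventually_gt_atTop 0] with n hn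
    simp only [varFactor, if_true]
    have := hn.ne'
    field_simp
    ring

/-- Normalisation of the conditional variances: `q n` stands for `p (1 - p)` with `p` the
proportion of white balls, or for its expectation. -/
lemma UrnScheme.tendsto_variance_div [IsProbabilityMeasure μ]
    (hurn : UrnScheme μ mdlM m a b σ W0 B0 W B R F)
    (ham : 1 ≤ a m) (hb0 : 1 ≤ b 0) (hΛ0 : 0 < urnIndex m a σ) (hΛ1 : urnIndex m a σ < 1)
    {q : ℕ → ℝ}
    (hq : Tendsto q atTop (𝓝 (urnZeta m a σ / σ * (1 - urnZeta m a σ / σ)))) :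
    Tendsto (fun n : ℕ => urnG (W0 + B0) σ (urnIndex m a σ) (n + 1) ^ 2 *
      ((a (m - 1) : ℝ) - a m) ^ 2 * m * varFactor mdlM m (((W0 + B0 : ℕ) : ℝ) + σ * n) * q n /
        ((a m : ℝ) * (b 0 : ℝ) * urnQ (W0 + B0) σ (urnIndex m a σ) ^ 2 *
              urnIndex m a σ ^ 2 / ((m : ℝ) * (1 - urnIndex m a σ) ^ 2) *
            (n : ℝ) ^ (-(2 * urnIndex m a σ)))) atTop (𝓝 1) := by
  have := nonempty_of_isProbabilityMeasure μ
  have hT := hurn.initial_pos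
  have hσ : (0 : ℝ) < σ := by exact_mod_cast hurn.hσ
  have hm : (0 : ℝ) < m := by exact_mod_cast hurn.hm
  have ha : (0 : ℝ) < a m := by exact_mod_cast ham
  have hb : (0 : ℝ) < b 0 := by exact_mod_cast hb0
  have hQ := urnQ_pos hT hurn.hσ hΛ0
  have h1Λ : 0 < 1 - urnIndex m a σ := by linarith
  have hb0' : (b 0 : ℝ) = σ * (1 - urnIndex m a σ) - a m := by
    have h1 := hurn.balanced 0 (Nat.zero_le _)
    have h2 := hurn.affine 0 (Nat.zero_le _)
    have h3 : (a 0 : ℝ) + b 0 = σ := by exact_mod_cast h1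
    have h4 : (a 0 : ℝ) = m * ((a (m - 1) : ℝ) - a m) + a m := by
      rw [h2]
      push_cast
      ring
    rw [hurn.sub_eq_index] at h4
    field_simp at h4
    linear_combination h3 - h4
  have hlim := ((((tendsto_urnG_succ_mul_rpow hT hurn.hσ hΛ0).pow 2).mul
    (tendsto_varFactor (mdlM := mdlM) (m := m) (T0 := ((W0 + B0 : ℕ) : ℝ)) hurn.hσ)).mul
    hq).const_mul (((a (m - 1) : ℝ) - a m) ^ 2 * m / ((a m : ℝ) * (b 0 : ℝ) *
      urnQ (W0 + B0) σ (urnIndex m a σ) ^ 2 * urnIndex m a σ ^ 2 /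
        ((m : ℝ) * (1 - urnIndex m a σ) ^ 2)))
  have h1 : ((a (m - 1) : ℝ) - a m) ^ 2 * m / ((a m : ℝ) * (b 0 : ℝ) *
      urnQ (W0 + B0) σ (urnIndex m a σ) ^ 2 * urnIndex m a σ ^ 2 /
        ((m : ℝ) * (1 - urnIndex m a σ) ^ 2)) * (urnQ (W0 + B0) σ (urnIndex m a σ) ^ 2 * 1 *
          (urnZeta m a σ / σ * (1 - urnZeta m a σ / σ))) = 1 := by
    have h2 : 1 - urnZeta m a σ / σ = b 0 / (σ * (1 - urnIndex m a σ)) := by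
      rw [hb0', urnZeta]
      field_simp
    rw [h2, hurn.sub_eq_index, urnZeta]
    field_simp
  rw [h1] at hlim
  refine hlim.congr' ?_
  filter_upwards [eventually_gt_atTop 0] with n hn
  have hn' : (0 : ℝ) < n := by exact_mod_cast hn
  have := Real.rpow_pos_of_pos hn' (urnIndex m a σ)
  rw [rpow_neg_two_mul hn']
  field_simp

end Urn

/-- Second-moment asymptotics of the martingale differences in
large-index urns: a.s. `E[X_{n+1}² | F_n] ~ c n^{-2Λ}`, `E[X_{n+1}²] ~ c n^{-2Λ}` and
`s_n² = ∑_{i≥n} E[X_i²] ~ c n^{1-2Λ}/(2Λ-1)`, with `c = a_m b₀ Q² Λ²/(m(1-Λ)²)`. -/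
theorem largeIndex_second_moments {Ω : Type*} [m0 : MeasurableSpace Ω] (μ : Measure Ω)
    [IsProbabilityMeasure μ] (mdlM : Bool) (m : ℕ) (a b : ℕ → ℤ) (σ : ℤ) (W0 B0 : ℕ)
    (W B : ℕ → Ω → ℕ) (R : ℕ → Ω → ℕ) (F : Filtration ℕ m0)
    (hurn : UrnScheme μ mdlM m a b σ W0 B0 W B R F)
    (ham : 1 ≤ a m) (hb0 : 1 ≤ b 0)
    (hΛlo : 1 / 2 < urnIndex m a σ) (hΛhi : urnIndex m a σ < 1) :
    (∀ᵐ ω ∂μ, Tendsto (fun n : ℕ =>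
        (μ[fun ω' => (calX μ σ (urnIndex m a σ) (W0 + B0) W (n + 1) ω') ^ 2 | F n]) ω /
          ((a m : ℝ) * (b 0 : ℝ) * urnQ (W0 + B0) σ (urnIndex m a σ) ^ 2 *
              urnIndex m a σ ^ 2 / ((m : ℝ) * (1 - urnIndex m a σ) ^ 2) *
            (n : ℝ) ^ (-(2 * urnIndex m a σ))))
      atTop (𝓝 1)) ∧
    Tendsto (fun n : ℕ =>
        (∫ ω, (calX μ σ (urnIndex m a σ) (W0 + B0) W (n + 1) ω) ^ 2 ∂μ) /
          ((a m : ℝ) * (b 0 : ℝ) * urnQ (W0 + B0) σ (urnIndex m a σ) ^ 2 *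
              urnIndex m a σ ^ 2 / ((m : ℝ) * (1 - urnIndex m a σ) ^ 2) *
            (n : ℝ) ^ (-(2 * urnIndex m a σ))))
      atTop (𝓝 1) ∧
    Tendsto (fun n : ℕ =>
        (∑' i : ℕ, ∫ ω, (calX μ σ (urnIndex m a σ) (W0 + B0) W (n + i) ω) ^ 2 ∂μ) /
          ((a m : ℝ) * (b 0 : ℝ) * urnQ (W0 + B0) σ (urnIndex m a σ) ^ 2 *
              urnIndex m a σ ^ 2 /
              ((m : ℝ) * (2 * urnIndex m a σ - 1) * (1 - urnIndex m a σ) ^ 2) *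
            (n : ℝ) ^ (1 - 2 * urnIndex m a σ)))
      atTop (𝓝 1) := by
  have hne := nonempty_of_isProbabilityMeasure μ
  have hΛ0 : 0 < urnIndex m a σ := by linarith
  have hX : ∀ n ω, calX μ σ (urnIndex m a σ) (W0 + B0) W (n + 1) ω =
      urnIncr m a σ (W0 + B0) n (R (n + 1) ω) (W n ω) := hurn.calX_succ hΛ0 hΛhi
  have hratio := hurn.ae_tendsto_white_ratio hΛlo hΛhi
  have hprod : ∀ᵐ ω ∂μ, Tendsto (fun n : ℕ => (W n ω : ℝ) / (((W0 + B0 : ℕ) : ℝ) + σ * n) *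
      (1 - (W n ω : ℝ) / (((W0 + B0 : ℕ) : ℝ) + σ * n))) atTop
      (𝓝 (urnZeta m a σ / σ * (1 - urnZeta m a σ / σ))) := by
    filter_upwards [hratio] with ω hω
    exact hω.mul (hω.const_sub 1)
  have hsecond : Tendsto (fun n : ℕ =>
        (∫ ω, (calX μ σ (urnIndex m a σ) (W0 + B0) W (n + 1) ω) ^ 2 ∂μ) /
          ((a m : ℝ) * (b 0 : ℝ) * urnQ (W0 + B0) σ (urnIndex m a σ) ^ 2 *
              urnIndex m a σ ^ 2 / ((m : ℝ) * (1 - urnIndex m a σ) ^ 2) *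
            (n : ℝ) ^ (-(2 * urnIndex m a σ)))) atTop (𝓝 1) := by
    have hInt : Tendsto (fun n : ℕ => ∫ ω, (W n ω : ℝ) / (((W0 + B0 : ℕ) : ℝ) + σ * n) *
        (1 - (W n ω : ℝ) / (((W0 + B0 : ℕ) : ℝ) + σ * n)) ∂μ) atTop
        (𝓝 (urnZeta m a σ / σ * (1 - urnZeta m a σ / σ))) := by
      have h := tendsto_integral_of_dominated_convergence (μ := μ) (fun _ => (1 : ℝ))
        (fun n => (hurn.integrable_draw n fun _ w => (w : ℝ) / (((W0 + B0 : ℕ) : ℝ) + σ * n) *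
          (1 - (w : ℝ) / (((W0 + B0 : ℕ) : ℝ) + σ * n))).aestronglyMeasurable)
        (integrable_const _) (fun n => ae_of_all _ fun ω => ?_) hprod
      · simpa using h
      · obtain ⟨h0, h1⟩ := hurn.white_ratio_mem n ω
        rw [Real.norm_eq_abs, abs_le]
        constructor <;> nlinarith
    refine (hurn.tendsto_variance_div ham hb0 hΛ0 hΛhi hInt).congr' ?_
    filter_upwards [eventually_gt_atTop 0] with n hn
    simp only [hX]
    rw [hurn.integral_draw n fun r w => urnIncr m a σ (W0 + B0) n r w ^ 2]
    simp only [hurn.sum_sq_urnIncr_mul_sampleProb hn]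
    rw [integral_const_mul]
  refine ⟨?_, hsecond, ?_⟩
  · have hcond : ∀ᵐ ω ∂μ, ∀ n,
        (μ[fun ω' => (calX μ σ (urnIndex m a σ) (W0 + B0) W (n + 1) ω') ^ 2 | F n]) ω =
        ∑ k ∈ Finset.range (m + 1), urnIncr m a σ (W0 + B0) n k (W n ω) ^ 2 *
          sampleProb mdlM m k (W n ω) (B n ω) := by
      rw [ae_all_iff]
      intro n
      simp only [hX]
      exact hurn.condExp_draw n fun r w => urnIncr m a σ (W0 + B0) n r w ^ 2
    filter_upwards [hcond, hprod] with ω h1 h2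
    refine (hurn.tendsto_variance_div ham hb0 hΛ0 hΛhi h2).congr' ?_
    filter_upwards [eventually_gt_atTop 0] with n hn
    rw [h1 n, hurn.sum_sq_urnIncr_mul_sampleProb hn]
  · have hp : 0 < 2 * urnIndex m a σ - 1 := by linarith
    have hm : (0 : ℝ) < m := by exact_mod_cast hurn.hm
    have ha : (0 : ℝ) < a m := by exact_mod_cast ham
    have hb : (0 : ℝ) < b 0 := by exact_mod_cast hb0
    have hQ := urnQ_pos hurn.initial_pos hurn.hσ hΛ0
    have h1Λ : 0 < 1 - urnIndex m a σ := by linarith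
    set c : ℝ := (a m : ℝ) * (b 0 : ℝ) * urnQ (W0 + B0) σ (urnIndex m a σ) ^ 2 *
      urnIndex m a σ ^ 2 / ((m : ℝ) * (1 - urnIndex m a σ) ^ 2) with hc
    have hc0 : 0 < c := by positivity
    set f : ℕ → ℝ := fun n => ∫ ω, (calX μ σ (urnIndex m a σ) (W0 + B0) W n ω) ^ 2 ∂μ
    have hf : Tendsto (fun n : ℕ => f n / (n : ℝ) ^ (-((2 * urnIndex m a σ - 1) + 1))) atTop
        (𝓝 c) := by
      rw [← tendsto_add_atTop_iff_nat 1]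
      have h1 := ((tendsto_natCast_div_add_atTop (1 : ℝ)).rpow_const
        (p := -(2 * urnIndex m a σ)) (Or.inl one_ne_zero)).const_mul c
      have h2 := hsecond.mul h1
      rw [Real.one_rpow, mul_one, one_mul] at h2
      refine h2.congr' ?_
      filter_upwards [eventually_gt_atTop 0] with n hn
      have hn' : (0 : ℝ) < n := by exact_mod_cast hn
      have e1 := Real.rpow_pos_of_pos hn' (-(2 * urnIndex m a σ))
      rw [sub_add_cancel, Real.div_rpow hn'.le (by positivity)]
      push_cast
      field_simp
      rfl
    have h := (tendsto_tsum_tail_div_rpow hp hf).div_const (c / (2 * urnIndex m a σ - 1))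
    rw [div_self (by positivity)] at h
    refine h.congr fun n => ?_
    rw [div_div, hc, neg_sub]
    congr 1
    field_simp
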